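/- Let d n be natural numbers, let a : Fin n → EuclideanSpace ℝ (Fin d) and y : Fin n → ℝ, and for each i let f i (β) = (⟪a i, β⟫ - y i)^2. Let I be a nonempty finite subset of Fin n. Then there exists a subset I_s ⊆ I with card I_s ≤ d + 1 such that the infimum over β ∈ EuclideanSpace ℝ (Fin d) of max_{i ∈ I_s} f i (β) equals the infimum over β of max_{i ∈ I} f i (β). -/

import Mathlib

open RealInnerProductSpace

/-- The infimum of a finite maximum of convex functions that are bounded below on a
finite-dimensional space equals that for a subfamily of at most `finrank ℝ E + 1` of them. -/
theorem exists_subset_card_le_iInf_sup'_eq {ι E : Type*} [AddCommGroup E] [Module ℝ E]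
    [FiniteDimensional ℝ E] {f : ι → E → ℝ} {s : Finset ι} (hs : s.Nonempty)
    (hconv : ∀ i ∈ s, ConvexOn ℝ Set.univ (f i))
    (hbdd : ∀ i ∈ s, BddBelow (Set.range (f i))) :
    ∃ (t : Finset ι) (_ : t ⊆ s) (ht : t.Nonempty), t.card ≤ Module.finrank ℝ E + 1 ∧
      (⨅ x, t.sup' ht fun i => f i x) = ⨅ x, s.sup' hs fun i => f i x := by
  classical
  have hsup (t : Finset ι) (hts : t ⊆ s) (ht : t.Nonempty) :
      BddBelow (Set.range fun x => t.sup' ht fun i => f i x) := by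
    obtain ⟨i, hi⟩ := ht
    obtain ⟨b, hb⟩ := hbdd i (hts hi)
    refine ⟨b, ?_⟩
    rintro _ ⟨x, rfl⟩
    exact (hb ⟨x, rfl⟩).trans (Finset.le_sup' (fun i => f i x) hi)
  let value (t : Finset ι) : ℝ :=
    if ht : t.Nonempty then ⨅ x, t.sup' ht fun i => f i x else 0
  let candidates : Finset (Finset ι) :=
    {t ∈ s.powerset | t.Nonempty ∧ t.card ≤ Module.finrank ℝ E + 1}
  have hcand : candidates.Nonempty := by
    obtain ⟨i, hi⟩ := hs
    exact ⟨{i}, by simp [candidates, hi]⟩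
  obtain ⟨t, ht_mem, ht_max⟩ := candidates.exists_max_image value hcand
  obtain ⟨hts, ht, ht_card⟩ : t ⊆ s ∧ t.Nonempty ∧ t.card ≤ Module.finrank ℝ E + 1 := by
    simpa [candidates] using ht_mem
  refine ⟨t, hts, ht, ht_card, le_antisymm ?_ ?_⟩
  · exact ciInf_mono (hsup t hts ht) fun x => Finset.sup'_mono _ hts ht
  · refine le_of_forall_pos_le_add fun ε hε => ?_
    obtain ⟨x, hx⟩ : (⋂ i ∈ s, {x | f i x < (⨅ x, t.sup' ht fun i => f i x) + ε}).Nonempty := by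
      refine Convex.helly_theorem' (𝕜 := ℝ)
        (fun i hi => by simpa using (hconv i hi).convex_lt _) fun u hus hu_card => ?_
      obtain rfl | hu := u.eq_empty_or_nonempty
      · simp
      have hle : value u ≤ value t := ht_max u (by simp [candidates, hus, hu, hu_card])
      simp only [value, dif_pos hu, dif_pos ht] at hle
      obtain ⟨x, hx⟩ := exists_lt_of_ciInf_lt (hle.trans_lt (lt_add_of_pos_right _ hε))
      exact ⟨x, by simpa using hx⟩
    refine (ciInf_le (hsup s subset_rfl hs) x).trans (Finset.sup'_le _ _ fun i hi => ?_)
    simp only [Set.mem_iInter, Set.mem_ofPred_eq] at hx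
    exact (hx i hi).le

theorem convexOn_inner_sub_sq {E : Type*} [NormedAddCommGroup E] [InnerProductSpace ℝ E]
    (a : E) (y : ℝ) : ConvexOn ℝ Set.univ fun x => (⟪a, x⟫ - y) ^ 2 := by
  have h := ((even_two.convexOn_pow (𝕜 := ℝ)).translate_left (-y)).comp_linearMap
    (innerSL ℝ a).toLinearMap
  simpa [Function.comp_def, sub_eq_add_neg] using h

/-- The `L∞` minimax problem with squared residuals over `I` is equivalent
to a sub-problem over a subset `I_s ⊆ I` of at most `d + 1` measurements. -/
theorem linf_subproblem_card_le_sq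
    (d n : ℕ) (a : Fin n → EuclideanSpace ℝ (Fin d)) (y : Fin n → ℝ)
    (f : Fin n → EuclideanSpace ℝ (Fin d) → ℝ)
    (hf : ∀ i β, f i β = (⟪a i, β⟫ - y i) ^ 2)
    (I : Finset (Fin n)) (hI : I.Nonempty) :
    ∃ (Is : Finset (Fin n)) (_ : Is ⊆ I) (hne : Is.Nonempty),
      Is.card ≤ d + 1 ∧
      (⨅ β : EuclideanSpace ℝ (Fin d), Is.sup' hne (fun i => f i β)) =
        (⨅ β : EuclideanSpace ℝ (Fin d), I.sup' hI (fun i => f i β)) := by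
  obtain ⟨Is, hsub, hne, hcard, heq⟩ := exists_subset_card_le_iInf_sup'_eq (f := f) hI
    (fun i _ => by simpa only [← hf] using convexOn_inner_sub_sq (a i) (y i))
    (fun i _ => ⟨0, by rintro _ ⟨β, rfl⟩; simpa only [hf] using sq_nonneg _⟩)
  exact ⟨Is, hsub, hne, by simpa using hcard, heq⟩
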